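/- Suppose lₙ is the all-zeros bitstring and there is an enumeration i₁, …, iₙ of {1, …, n} (a bijection) with i₁ = 1, iₙ = n, and Hamming distance exactly 1 between l_{i_p} and l_{i_{p+1}} for every 1 ≤ p ≤ n − 1. Then there exist permutations g₁, …, g_{2n−1} of S, each equal to X j or Y i for some i, j ∈ I, such that g_{2n−1} ⋯ g₂ · g₁ · t is the identity permutation of S. -/

import Mathlib

namespace RSq

def I (h : ℕ) : Type := {i : ℤ // i ≠ 0 ∧ |i| ≤ (h : ℤ)}

instance (h : ℕ) : DecidableEq (I h) :=
  inferInstanceAs (DecidableEq {i : ℤ // i ≠ 0 ∧ |i| ≤ (h : ℤ)})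

instance (h : ℕ) : Neg (I h) :=
  ⟨fun i => ⟨-i.1, neg_ne_zero.mpr i.2.1, by rw [abs_neg]; exact i.2.2⟩⟩

@[simp] theorem I.neg_neg {h : ℕ} (i : I h) : -(-i) = i :=
  Subtype.ext (by show -(-i.1) = i.1; exact _root_.neg_neg i.1)

abbrev S (h : ℕ) : Type := I h × I h × (ZMod 2 × ZMod 2)

@[simp] theorem zmod2_add_one_one (ε : ZMod 2) : ε + 1 + 1 = ε := by revert ε; decide

/-- Column move: flips column `j`. -/
def X {h : ℕ} (j : I h) : Equiv.Perm (S h) :=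
  Function.Involutive.toPerm
    (fun s => if s.1 = j then (s.1, -s.2.1, (s.2.2.1 + 1, s.2.2.2)) else s)
    (by
      rintro ⟨c, r, ε₁, ε₂⟩
      by_cases hc : c = j <;> simp [hc])

/-- Row move: flips row `i`. -/
def Y {h : ℕ} (i : I h) : Equiv.Perm (S h) :=
  Function.Involutive.toPerm
    (fun s => if s.2.1 = i then (-s.1, s.2.1, (s.2.2.1, s.2.2.2 + 1)) else s)
    (by
      rintro ⟨c, r, ε₁, ε₂⟩
      by_cases hr : r = i <;> simp [hr])

/-- The side-length parameter: `h = max m n + 2n`. -/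
abbrev hS (n m : ℕ) : ℕ := max m n + 2 * n

def bit {m : ℕ} (w : Fin m → Bool) (c : ℤ) : Bool :=
  if hc : 1 ≤ c ∧ c ≤ (m : ℤ) then w ⟨(c - 1).toNat, by omega⟩ else false

def colIdx {n m : ℕ} (j : Fin m) : I (hS n m) :=
  ⟨((j : ℕ) : ℤ) + 1, by
    have hj : (j : ℕ) < m := j.isLt
    have hm : m ≤ hS n m := le_trans (le_max_left m n) (Nat.le_add_right _ _)
    constructor
    · omega
    · rw [abs_of_nonneg (by omega)]; omega⟩

def rowIdx {n m : ℕ} (i : Fin n) : I (hS n m) :=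
  ⟨((i : ℕ) : ℤ) + 1, by
    have hi : (i : ℕ) < n := i.isLt
    have hn : n ≤ hS n m := le_trans (le_max_right m n) (Nat.le_add_right _ _)
    constructor
    · omega
    · rw [abs_of_nonneg (by omega)]; omega⟩

/-- `aᵢ := (X 1)^{lᵢ(1)} ⋯ (X m)^{lᵢ(m)}`. -/
def a {n m : ℕ} (l : Fin n → Fin m → Bool) (i : Fin n) : Equiv.Perm (S (hS n m)) :=
  ((List.finRange m).map (fun j => X (colIdx (n := n) j) ^ (if l i j then 1 else 0))).prod

/-- `bᵢ := aᵢ⁻¹ · (Y i) · aᵢ`. -/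
def b {n m : ℕ} (l : Fin n → Fin m → Bool) (i : Fin n) : Equiv.Perm (S (hS n m)) :=
  (a l i)⁻¹ * Y (rowIdx (m := m) i) * a l i

/-- `t := a₁ · b₁ · b₂ ⋯ bₙ`. -/
def t {n m : ℕ} (hn : 0 < n) (l : Fin n → Fin m → Bool) : Equiv.Perm (S (hS n m)) :=
  a l ⟨0, hn⟩ * ((List.finRange n).map (b l)).prod


theorem X_mul_self {h : ℕ} (j : I h) : X j * X j = 1 :=
  Equiv.ext (X j).left_inv

theorem Y_mul_self {h : ℕ} (i : I h) : Y i * Y i = 1 :=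
  Equiv.ext (Y i).left_inv

theorem X_apply {h : ℕ} (j : I h) (s : S h) :
    X j s = if s.1 = j then (s.1, -s.2.1, (s.2.2.1 + 1, s.2.2.2)) else s := rfl

theorem Y_apply {h : ℕ} (i : I h) (s : S h) :
    Y i s = if s.2.1 = i then (-s.1, s.2.1, (s.2.2.1, s.2.2.2 + 1)) else s := rfl

theorem X_commute {h : ℕ} (j k : I h) : Commute (X j) (X k) := by
  rcases eq_or_ne j k with rfl | hjk
  · exact Commute.refl _
  · refine Equiv.Perm.Disjoint.commute fun s => ?_
    by_cases hs : s.1 = j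
    · exact Or.inr (by rw [X_apply, if_neg (hs ▸ hjk)])
    · exact Or.inl (by rw [X_apply, if_neg hs])

theorem abs_row_X {h : ℕ} (j : I h) (s : S h) : |(X j s).2.1.1| = |s.2.1.1| := by
  rw [X_apply]
  split_ifs
  · exact abs_neg _
  · rfl

theorem abs_row_list_prod {h : ℕ} (L : List (Equiv.Perm (S h)))
    (hL : ∀ p ∈ L, ∀ s : S h, |(p s).2.1.1| = |s.2.1.1|) (s : S h) :
    |(L.prod s).2.1.1| = |s.2.1.1| := by
  induction L with
  | nil => rfl
  | cons p L ih =>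
    rw [List.prod_cons, Equiv.Perm.mul_apply, hL p List.mem_cons_self,
      ih fun q hq => hL q (List.mem_cons_of_mem _ hq)]

theorem abs_row_a {n m : ℕ} (l : Fin n → Fin m → Bool) (i : Fin n) (s : S (hS n m)) :
    |(a l i s).2.1.1| = |s.2.1.1| := by
  refine abs_row_list_prod _ (fun p hp s => ?_) s
  obtain ⟨j, -, rfl⟩ := List.mem_map.mp hp
  split_ifs
  · rw [pow_one, abs_row_X]
  · rw [pow_zero, Equiv.Perm.one_apply]

theorem b_apply_of_abs_row_ne {n m : ℕ} (l : Fin n → Fin m → Bool) (i : Fin n)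
    (s : S (hS n m)) (hs : |s.2.1.1| ≠ (i : ℤ) + 1) : b l i s = s := by
  have hrow : (a l i s).2.1 ≠ rowIdx (m := m) i := fun hr => hs <| by
    rw [← abs_row_a l i s, hr]
    exact abs_of_nonneg (show (0 : ℤ) ≤ (i : ℤ) + 1 by positivity)
  rw [b, Equiv.Perm.mul_apply, Equiv.Perm.mul_apply, Y_apply, if_neg hrow,
    ← Equiv.Perm.mul_apply, inv_mul_cancel, Equiv.Perm.one_apply]

theorem b_commute {n m : ℕ} (l : Fin n → Fin m → Bool) (i j : Fin n) :
    Commute (b l i) (b l j) := by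
  rcases eq_or_ne i j with rfl | hij
  · exact Commute.refl _
  · refine Equiv.Perm.Disjoint.commute fun s => ?_
    by_cases hs : |s.2.1.1| = (i : ℤ) + 1
    · refine Or.inr (b_apply_of_abs_row_ne l j s fun hj => hij (Fin.ext ?_))
      omega
    · exact Or.inl (b_apply_of_abs_row_ne l i s hs)

/-- Two products of commuting involutions whose exponents differ at a single index `j`
differ by the involution at `j`. -/
theorem list_prod_mul_inv_eq {G ι : Type*} [Group G] (x : ι → G)
    (hcomm : ∀ j k, Commute (x j) (x k)) (u v : ι → Bool) (j : ι)
    (hx : x j * x j = 1) (huv : u j ≠ v j) (hoff : ∀ k, k ≠ j → u k = v k) (L : List ι)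
    (hL : L.Nodup) (hj : j ∈ L) :
    (L.map fun k => x k ^ (if u k then 1 else 0)).prod *
      (L.map fun k => x k ^ (if v k then 1 else 0)).prod⁻¹ = x j := by
  induction L with
  | nil => simp at hj
  | cons k L ih =>
    rw [List.nodup_cons] at hL
    simp only [List.map_cons, List.prod_cons, mul_inv_rev]
    rcases eq_or_ne k j with rfl | hkj
    · have htail : (L.map fun i => x i ^ (if u i then 1 else 0)) =
          L.map fun i => x i ^ (if v i then 1 else 0) :=
        List.map_congr_left fun i hi => by rw [hoff i (ne_of_mem_of_not_mem hi hL.1)]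
      rw [htail, mul_assoc, mul_inv_cancel_left]
      cases hu : u k <;> cases hv : v k <;> simp_all [inv_eq_iff_mul_eq_one]
    · have hjL : j ∈ L := (List.mem_cons.mp hj).resolve_left hkj.symm
      rw [mul_assoc, ← mul_assoc (List.prod _), ih hL.2 hjL, hoff k hkj, ← mul_assoc,
        ((hcomm k j).pow_left _).eq, mul_inv_cancel_right]

theorem a_mul_inv_eq_X {n m : ℕ} (l : Fin n → Fin m → Bool) (i i' : Fin n)
    (hd : hammingDist (l i) (l i') = 1) :
    ∃ j : I (hS n m), a l i * (a l i')⁻¹ = X j := by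
  obtain ⟨j, hj⟩ := Finset.card_eq_one.mp hd
  have hmem : ∀ k, l i k ≠ l i' k ↔ k = j := fun k => by
    simpa using Finset.ext_iff.mp hj k
  exact ⟨colIdx j, list_prod_mul_inv_eq (fun k => X (colIdx (n := n) k))
    (fun _ _ => X_commute _ _) (l i) (l i') j (X_mul_self _) ((hmem j).mpr rfl)
    (fun k hk => not_not.mp (mt (hmem k).mp hk)) _ (List.nodup_finRange m)
    (List.mem_finRange j)⟩

/-- A product of conjugates telescopes into an alternating word. -/
theorem exists_list_prod_eq_of_conj {G : Type*} [Group G] (P : G → Prop) (k : ℕ)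
    (A B : Fin (k + 1) → G) (hB : ∀ p, P (B p))
    (hA : ∀ p : Fin k, P (A p.castSucc * (A p.succ)⁻¹)) (hlast : A (Fin.last k) = 1) :
    ∃ L : List G, L.length = 2 * k + 1 ∧ (∀ x ∈ L, P x) ∧
      L.prod = A 0 * (List.ofFn fun p => (A p)⁻¹ * B p * A p).prod := by
  induction k with
  | zero =>
    have h0 : A 0 = 1 := hlast
    exact ⟨[B 0], rfl, by simpa using hB 0, by simp [h0]⟩
  | succ k ih =>
    obtain ⟨L, hlen, hP, hprod⟩ := ih (fun p => A p.succ) (fun p => B p.succ)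
      (fun p => hB _) (fun p => hA p.succ) hlast
    refine ⟨B 0 :: (A 0 * (A 1)⁻¹) :: L, by simp [hlen]; omega, ?_, ?_⟩
    · simpa using ⟨hB 0, hA 0, hP⟩
    · rw [List.ofFn_succ]
      simp only [List.prod_cons, hprod, Fin.succ_zero_eq_one]
      group

theorem reverse_prod_mul_prod {G : Type*} [Group G] (L : List G)
    (hL : ∀ x ∈ L, x * x = 1) : L.reverse.prod * L.prod = 1 := by
  induction L with
  | nil => simp
  | cons x L ih =>
    rw [List.reverse_cons, List.prod_append, List.prod_singleton, List.prod_cons, mul_assoc,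
      ← mul_assoc x, hL x List.mem_cons_self, one_mul,
      ih fun y hy => hL y (List.mem_cons_of_mem _ hy)]

theorem prod_map_b_eq_ofFn {n m : ℕ} (l : Fin n → Fin m → Bool) (σ : Equiv.Perm (Fin n)) :
    ((List.finRange n).map (b l)).prod = (List.ofFn fun p => b l (σ p)).prod := by
  have hperm := ((Equiv.Perm.map_finRange_perm σ).map (b l)).symm
  rw [hperm.prod_eq' (List.pairwise_map.mpr (List.pairwise_of_forall fun i j => b_commute l i j)),
    List.map_map, List.ofFn_eq_map]
  rfl

/-- a Hamiltonian path yields a `2n - 1`-move inversion of `t`. -/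
theorem stmt_2 (n m : ℕ) (hn : 0 < n) (hm : 0 < m) (l : Fin n → Fin m → Bool)
    (hlast : l ⟨n - 1, by omega⟩ = fun _ => false)
    (σ : Equiv.Perm (Fin n))
    (hfirst : σ ⟨0, hn⟩ = ⟨0, hn⟩)
    (hend : σ ⟨n - 1, by omega⟩ = ⟨n - 1, by omega⟩)
    (hham : ∀ (p : ℕ) (hp : p + 1 < n),
      hammingDist (l (σ ⟨p, by omega⟩)) (l (σ ⟨p + 1, hp⟩)) = 1) :
    ∃ g : Fin (2 * n - 1) → Equiv.Perm (S (hS n m)),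
      (∀ q, (∃ j, g q = X j) ∨ (∃ i, g q = Y i)) ∧
      (List.ofFn g).reverse.prod * t hn l = 1 := by
  obtain ⟨k, rfl⟩ : ∃ k, n = k + 1 := ⟨n - 1, by omega⟩
  have ha_last : a l (σ (Fin.last k)) = 1 := by
    rw [show σ (Fin.last k) = Fin.last k from hend, a, show l (Fin.last k) = _ from hlast]
    simp
  obtain ⟨L, hlen, hP, hprod⟩ := exists_list_prod_eq_of_conj
    (fun x : Equiv.Perm (S (hS (k + 1) m)) => (∃ j, x = X j) ∨ (∃ i, x = Y i)) k
    (fun p => a l (σ p)) (fun p => Y (rowIdx (σ p))) (fun p => Or.inr ⟨_, rfl⟩)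
    (fun p => Or.inl (a_mul_inv_eq_X l _ _ (hham p (by omega)))) ha_last
  have ht : L.prod = t hn l := by
    rw [hprod, t, prod_map_b_eq_ofFn l σ, ← hfirst]
    rfl
  have hlen' : 2 * (k + 1) - 1 = L.length := by omega
  refine ⟨fun q => L.get (q.cast hlen'), fun q => hP _ (List.get_mem _ _), ?_⟩
  have hofFn : List.ofFn (fun q : Fin (2 * (k + 1) - 1) => L.get (q.cast hlen')) = L := by
    rw [← List.ofFn_congr hlen'.symm, List.ofFn_get]
  rw [hofFn, ← ht]
  refine reverse_prod_mul_prod L fun x hx => ?_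
  rcases hP x hx with ⟨j, rfl⟩ | ⟨i, rfl⟩
  · exact X_mul_self j
  · exact Y_mul_self i

end RSq
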